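/- Let κ ∈ ℝ and let u = (u₁,u₂) : ℝ² × ℝ → ℝ² and η : ℝ² × ℝ → ℝ be smooth with η > 0, solving the 2D BKBK system ∂_t u + (v·∇)u + Σ_{j=1,2} u_j ∇v_j = ∇𝓑, ∂_t η + div(η v) = 0, where v := u − κ∇ln η and 𝓑 := |u|²/2 − (κ/η) div(η u) − η. Then the pair (v, η) satisfies ∂_t v + (v·∇)v + Σ_{j=1,2} v_j ∇v_j = ∇B̂ and ∂_t η + div(v η) = 0, where B̂ := |v|²/2 + (κ²/2)|∇ln η|² − (κ²/η) Δη − η. -/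

import Mathlib

/-- partial derivative in the first spatial variable of a function of `(x, y, t)` -/
noncomputable def pd1 (f : ℝ → ℝ → ℝ → ℝ) (x y t : ℝ) : ℝ := deriv (fun x' => f x' y t) x

/-- partial derivative in the second spatial variable of a function of `(x, y, t)` -/
noncomputable def pd2 (f : ℝ → ℝ → ℝ → ℝ) (x y t : ℝ) : ℝ := deriv (fun y' => f x y' t) y

/-- temporal partial derivative of a function of `(x, y, t)` -/
noncomputable def pdt (f : ℝ → ℝ → ℝ → ℝ) (x y t : ℝ) : ℝ := deriv (fun t' => f x y t') t

open scoped ContDiff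

/-- Joint smoothness of a curried function of `(x, y, t)`. -/
def JointlySmooth (f : ℝ → ℝ → ℝ → ℝ) : Prop :=
  ContDiff ℝ ∞ (fun p : ℝ × ℝ × ℝ => f p.1 p.2.1 p.2.2)

namespace JointlySmooth

variable {f : ℝ → ℝ → ℝ → ℝ}

lemma hasFDerivAt (hf : JointlySmooth f) (p : ℝ × ℝ × ℝ) :
    HasFDerivAt (fun p : ℝ × ℝ × ℝ => f p.1 p.2.1 p.2.2)
      (fderiv ℝ (fun p : ℝ × ℝ × ℝ => f p.1 p.2.1 p.2.2) p) p :=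
  (ContDiff.differentiable hf (by simp) p).hasFDerivAt

lemma hasDerivAt_fderiv1 (hf : JointlySmooth f) (x y t : ℝ) :
    HasDerivAt (fun x' => f x' y t)
      (fderiv ℝ (fun p : ℝ × ℝ × ℝ => f p.1 p.2.1 p.2.2) (x, y, t) (1, 0, 0)) x := by
  have h : HasDerivAt (fun x' : ℝ => (x', y, t)) (1, 0, 0) x :=
    (hasDerivAt_id x).prodMk (hasDerivAt_const x (y, t))
  exact (hf.hasFDerivAt (x, y, t)).comp_hasDerivAt x h

lemma hasDerivAt_fderiv2 (hf : JointlySmooth f) (x y t : ℝ) :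
    HasDerivAt (fun y' => f x y' t)
      (fderiv ℝ (fun p : ℝ × ℝ × ℝ => f p.1 p.2.1 p.2.2) (x, y, t) (0, 1, 0)) y := by
  have h : HasDerivAt (fun y' : ℝ => (x, y', t)) (0, 1, 0) y :=
    (hasDerivAt_const y x).prodMk ((hasDerivAt_id y).prodMk (hasDerivAt_const y t))
  exact (hf.hasFDerivAt (x, y, t)).comp_hasDerivAt y h

lemma hasDerivAt_fderivt (hf : JointlySmooth f) (x y t : ℝ) :
    HasDerivAt (fun t' => f x y t')
      (fderiv ℝ (fun p : ℝ × ℝ × ℝ => f p.1 p.2.1 p.2.2) (x, y, t) (0, 0, 1)) t := by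
  have h : HasDerivAt (fun t' : ℝ => (x, y, t')) (0, 0, 1) t :=
    (hasDerivAt_const t x).prodMk ((hasDerivAt_const t y).prodMk (hasDerivAt_id t))
  exact (hf.hasFDerivAt (x, y, t)).comp_hasDerivAt t h

lemma pd1_eq (hf : JointlySmooth f) : pd1 f = fun x y t =>
    fderiv ℝ (fun p : ℝ × ℝ × ℝ => f p.1 p.2.1 p.2.2) (x, y, t) (1, 0, 0) := by
  funext x y t
  exact (hf.hasDerivAt_fderiv1 x y t).deriv

lemma pd2_eq (hf : JointlySmooth f) : pd2 f = fun x y t =>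
    fderiv ℝ (fun p : ℝ × ℝ × ℝ => f p.1 p.2.1 p.2.2) (x, y, t) (0, 1, 0) := by
  funext x y t
  exact (hf.hasDerivAt_fderiv2 x y t).deriv

lemma pdt_eq (hf : JointlySmooth f) : pdt f = fun x y t =>
    fderiv ℝ (fun p : ℝ × ℝ × ℝ => f p.1 p.2.1 p.2.2) (x, y, t) (0, 0, 1) := by
  funext x y t
  exact (hf.hasDerivAt_fderivt x y t).deriv

lemma hasDerivAt_pd1 (hf : JointlySmooth f) (x y t : ℝ) :
    HasDerivAt (fun x' => f x' y t) (pd1 f x y t) x :=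
  (hf.hasDerivAt_fderiv1 x y t).differentiableAt.hasDerivAt

lemma hasDerivAt_pd2 (hf : JointlySmooth f) (x y t : ℝ) :
    HasDerivAt (fun y' => f x y' t) (pd2 f x y t) y :=
  (hf.hasDerivAt_fderiv2 x y t).differentiableAt.hasDerivAt

lemma hasDerivAt_pdt (hf : JointlySmooth f) (x y t : ℝ) :
    HasDerivAt (fun t' => f x y t') (pdt f x y t) t :=
  (hf.hasDerivAt_fderivt x y t).differentiableAt.hasDerivAt

lemma fderiv_apply (hf : JointlySmooth f) (e : ℝ × ℝ × ℝ) : JointlySmooth fun x y t =>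
    fderiv ℝ (fun p : ℝ × ℝ × ℝ => f p.1 p.2.1 p.2.2) (x, y, t) e :=
  (ContDiff.fderiv_right (m := ∞) hf (by simp)).clm_apply contDiff_const

lemma pd1 (hf : JointlySmooth f) : JointlySmooth (pd1 f) :=
  hf.pd1_eq ▸ hf.fderiv_apply _

lemma pd2 (hf : JointlySmooth f) : JointlySmooth (pd2 f) :=
  hf.pd2_eq ▸ hf.fderiv_apply _

lemma fderiv_fderiv_apply_comm (hf : JointlySmooth f) (p a b : ℝ × ℝ × ℝ) :
    fderiv ℝ (fun q => fderiv ℝ (fun p : ℝ × ℝ × ℝ => f p.1 p.2.1 p.2.2) q a) p b =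
      fderiv ℝ (fun q => fderiv ℝ (fun p : ℝ × ℝ × ℝ => f p.1 p.2.1 p.2.2) q b) p a := by
  have hd : DifferentiableAt ℝ (fderiv ℝ (fun p : ℝ × ℝ × ℝ => f p.1 p.2.1 p.2.2)) p :=
    (ContDiff.fderiv_right (m := ∞) hf (by simp)).differentiable (by simp) p
  have hs : IsSymmSndFDerivAt ℝ (fun p : ℝ × ℝ × ℝ => f p.1 p.2.1 p.2.2) p :=
    (ContDiff.contDiffAt hf).isSymmSndFDerivAt
      (by rw [minSmoothness_of_isRCLikeNormedField]; exact WithTop.coe_le_coe.2 le_top)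
  rw [fderiv_clm_apply hd (differentiableAt_const a),
    fderiv_clm_apply hd (differentiableAt_const b)]
  simpa using hs.eq b a

lemma pd2_pd1 (hf : JointlySmooth f) (x y t : ℝ) :
    _root_.pd2 (_root_.pd1 f) x y t = _root_.pd1 (_root_.pd2 f) x y t := by
  rw [hf.pd1.pd2_eq, hf.pd2.pd1_eq, hf.pd1_eq, hf.pd2_eq]
  exact hf.fderiv_fderiv_apply_comm _ _ _

lemma hasDerivAt_pdt_pd1 (hf : JointlySmooth f) (x y t : ℝ) :
    HasDerivAt (fun x' => pdt f x' y t) (pdt (_root_.pd1 f) x y t) x := by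
  rw [hf.pd1.pdt_eq, hf.pdt_eq, hf.pd1_eq]
  exact ((hf.fderiv_apply (0, 0, 1)).hasDerivAt_fderiv1 x y t).congr_deriv
    (hf.fderiv_fderiv_apply_comm (x, y, t) (0, 0, 1) (1, 0, 0))

lemma hasDerivAt_pdt_pd2 (hf : JointlySmooth f) (x y t : ℝ) :
    HasDerivAt (fun y' => pdt f x y' t) (pdt (_root_.pd2 f) x y t) y := by
  rw [hf.pd2.pdt_eq, hf.pdt_eq, hf.pd2_eq]
  exact ((hf.fderiv_apply (0, 0, 1)).hasDerivAt_fderiv2 x y t).congr_deriv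
    (hf.fderiv_fderiv_apply_comm (x, y, t) (0, 0, 1) (0, 1, 0))

end JointlySmooth

/-- For smooth solutions of the 2D BKBK system with `η > 0`, the pair
`(v, η)` with `v = u − κ∇ln η` satisfies
`∂ₜv + (v·∇)v + Σⱼ vⱼ∇vⱼ = ∇B̂` and `∂ₜη + div(vη) = 0`, where
`B̂ := |v|²/2 + (κ²/2)|∇ln η|² − (κ²/η)Δη − η`. -/
theorem bkbk_2d_v_eta_form (κ : ℝ) (u1 u2 η : ℝ → ℝ → ℝ → ℝ)
    (hu1 : ContDiff ℝ (⊤ : ℕ∞) (fun p : ℝ × ℝ × ℝ => u1 p.1 p.2.1 p.2.2))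
    (hu2 : ContDiff ℝ (⊤ : ℕ∞) (fun p : ℝ × ℝ × ℝ => u2 p.1 p.2.1 p.2.2))
    (hη : ContDiff ℝ (⊤ : ℕ∞) (fun p : ℝ × ℝ × ℝ => η p.1 p.2.1 p.2.2))
    (hηpos : ∀ x y t, 0 < η x y t)
    (v1 v2 B : ℝ → ℝ → ℝ → ℝ)
    (hv1 : v1 = fun x y t => u1 x y t - κ * pd1 (fun x y t => Real.log (η x y t)) x y t)
    (hv2 : v2 = fun x y t => u2 x y t - κ * pd2 (fun x y t => Real.log (η x y t)) x y t)
    (hB : B = fun x y t => (u1 x y t ^ 2 + u2 x y t ^ 2) / 2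
        - (κ / η x y t) * (pd1 (fun x y t => η x y t * u1 x y t) x y t
            + pd2 (fun x y t => η x y t * u2 x y t) x y t)
        - η x y t)
    (hmom1 : ∀ x y t, pdt u1 x y t + v1 x y t * pd1 u1 x y t + v2 x y t * pd2 u1 x y t
        + u1 x y t * pd1 v1 x y t + u2 x y t * pd1 v2 x y t = pd1 B x y t)
    (hmom2 : ∀ x y t, pdt u2 x y t + v1 x y t * pd1 u2 x y t + v2 x y t * pd2 u2 x y t
        + u1 x y t * pd2 v1 x y t + u2 x y t * pd2 v2 x y t = pd2 B x y t)
    (hcont : ∀ x y t, pdt η x y t + pd1 (fun x y t => η x y t * v1 x y t) x y t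
        + pd2 (fun x y t => η x y t * v2 x y t) x y t = 0)
    (Bh : ℝ → ℝ → ℝ → ℝ)
    (hBh : Bh = fun x y t => (v1 x y t ^ 2 + v2 x y t ^ 2) / 2
        + (κ ^ 2 / 2) * ((pd1 (fun x y t => Real.log (η x y t)) x y t) ^ 2
            + (pd2 (fun x y t => Real.log (η x y t)) x y t) ^ 2)
        - (κ ^ 2 / η x y t) * (pd1 (pd1 η) x y t + pd2 (pd2 η) x y t)
        - η x y t) :
    (∀ x y t, pdt v1 x y t + v1 x y t * pd1 v1 x y t + v2 x y t * pd2 v1 x y t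
        + v1 x y t * pd1 v1 x y t + v2 x y t * pd1 v2 x y t = pd1 Bh x y t) ∧
    (∀ x y t, pdt v2 x y t + v1 x y t * pd1 v2 x y t + v2 x y t * pd2 v2 x y t
        + v1 x y t * pd2 v1 x y t + v2 x y t * pd2 v2 x y t = pd2 Bh x y t) ∧
    (∀ x y t, pdt η x y t + pd1 (fun x y t => v1 x y t * η x y t) x y t
        + pd2 (fun x y t => v2 x y t * η x y t) x y t = 0) := by
  have su1 : JointlySmooth u1 := hu1
  have su2 : JointlySmooth u2 := hu2
  have sη : JointlySmooth η := hη
  have hne : ∀ x y t, η x y t ≠ 0 := fun x y t => (hηpos x y t).ne'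
  have hcont' : ∀ x y t, pdt η x y t + pd1 (fun x y t => v1 x y t * η x y t) x y t
      + pd2 (fun x y t => v2 x y t * η x y t) x y t = 0 := by
    simpa only [mul_comm] using hcont
  set L : ℝ → ℝ → ℝ → ℝ := fun x y t => Real.log (η x y t)
  have sL : JointlySmooth L := ContDiff.log hη fun p => hne _ _ _
  have sp1 := sL.pd1
  have sp2 := sL.pd2
  have sv1 : JointlySmooth v1 := hv1 ▸ ContDiff.sub su1 (contDiff_const.mul sp1)
  have sv2 : JointlySmooth v2 := hv2 ▸ ContDiff.sub su2 (contDiff_const.mul sp2)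
  have eu1 : u1 = fun x y t => v1 x y t + κ * pd1 L x y t := by
    simp [hv1]
  have eu2 : u2 = fun x y t => v2 x y t + κ * pd2 L x y t := by
    simp [hv2]
  have eη1 : pd1 η = fun x y t => η x y t * pd1 L x y t := by
    funext x y t
    have h : pd1 L x y t = _ := ((sη.hasDerivAt_pd1 x y t).log (hne x y t)).deriv
    rw [h, mul_div_cancel₀ _ (hne x y t)]
  have eη2 : pd2 η = fun x y t => η x y t * pd2 L x y t := by
    funext x y t
    have h : pd2 L x y t = _ := ((sη.hasDerivAt_pd2 x y t).log (hne x y t)).deriv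
    rw [h, mul_div_cancel₀ _ (hne x y t)]
  have eηt : ∀ x y t, pdt η x y t = η x y t * pdt L x y t := by
    intro x y t
    have h : pdt L x y t = _ := ((sη.hasDerivAt_pdt x y t).log (hne x y t)).deriv
    rw [h, mul_div_cancel₀ _ (hne x y t)]
  have eη11 : ∀ x y t, pd1 (pd1 η) x y t
      = η x y t * (pd1 L x y t ^ 2 + pd1 (pd1 L) x y t) := by
    intro x y t
    have h : pd1 (fun x y t => η x y t * pd1 L x y t) x y t = _ :=
      ((sη.hasDerivAt_pd1 x y t).mul (sp1.hasDerivAt_pd1 x y t)).deriv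
    rw [eη1, h, eη1]
    ring
  have eη22 : ∀ x y t, pd2 (pd2 η) x y t
      = η x y t * (pd2 L x y t ^ 2 + pd2 (pd2 L) x y t) := by
    intro x y t
    have h : pd2 (fun x y t => η x y t * pd2 L x y t) x y t = _ :=
      ((sη.hasDerivAt_pd2 x y t).mul (sp2.hasDerivAt_pd2 x y t)).deriv
    rw [eη2, h, eη2]
    ring
  have eLt : pdt L = fun x y t => -(pd1 v1 x y t + pd2 v2 x y t)
      - (v1 x y t * pd1 L x y t + v2 x y t * pd2 L x y t) := by
    funext x y t
    have h1 : pd1 (fun x y t => v1 x y t * η x y t) x y t = _ :=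
      ((sv1.hasDerivAt_pd1 x y t).mul (sη.hasDerivAt_pd1 x y t)).deriv
    have h2 : pd2 (fun x y t => v2 x y t * η x y t) x y t = _ :=
      ((sv2.hasDerivAt_pd2 x y t).mul (sη.hasDerivAt_pd2 x y t)).deriv
    have h := hcont' x y t
    rw [h1, h2, eηt, eη1, eη2] at h
    apply mul_left_cancel₀ (hne x y t)
    linear_combination h
  have du11 : ∀ x y t, pd1 u1 x y t = pd1 v1 x y t + κ * pd1 (pd1 L) x y t := by
    intro x y t
    rw [eu1]
    exact ((sv1.hasDerivAt_pd1 x y t).add ((sp1.hasDerivAt_pd1 x y t).const_mul κ)).deriv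
  have du12 : ∀ x y t, pd2 u1 x y t = pd2 v1 x y t + κ * pd1 (pd2 L) x y t := by
    intro x y t
    rw [eu1, ← sL.pd2_pd1]
    exact ((sv1.hasDerivAt_pd2 x y t).add ((sp1.hasDerivAt_pd2 x y t).const_mul κ)).deriv
  have du1t : ∀ x y t, pdt u1 x y t = pdt v1 x y t + κ * pdt (pd1 L) x y t := by
    intro x y t
    rw [eu1]
    exact ((sv1.hasDerivAt_pdt x y t).add ((sp1.hasDerivAt_pdt x y t).const_mul κ)).deriv
  have du21 : ∀ x y t, pd1 u2 x y t = pd1 v2 x y t + κ * pd1 (pd2 L) x y t := by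
    intro x y t
    rw [eu2]
    exact ((sv2.hasDerivAt_pd1 x y t).add ((sp2.hasDerivAt_pd1 x y t).const_mul κ)).deriv
  have du22 : ∀ x y t, pd2 u2 x y t = pd2 v2 x y t + κ * pd2 (pd2 L) x y t := by
    intro x y t
    rw [eu2]
    exact ((sv2.hasDerivAt_pd2 x y t).add ((sp2.hasDerivAt_pd2 x y t).const_mul κ)).deriv
  have du2t : ∀ x y t, pdt u2 x y t = pdt v2 x y t + κ * pdt (pd2 L) x y t := by
    intro x y t
    rw [eu2]
    exact ((sv2.hasDerivAt_pdt x y t).add ((sp2.hasDerivAt_pdt x y t).const_mul κ)).deriv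
  have eBh : Bh = fun x y t => B x y t + κ * (pd1 v1 x y t + pd2 v2 x y t) := by
    funext x y t
    have h1 : pd1 (fun x y t => η x y t * u1 x y t) x y t = _ :=
      ((sη.hasDerivAt_pd1 x y t).mul (su1.hasDerivAt_pd1 x y t)).deriv
    have h2 : pd2 (fun x y t => η x y t * u2 x y t) x y t = _ :=
      ((sη.hasDerivAt_pd2 x y t).mul (su2.hasDerivAt_pd2 x y t)).deriv
    have hu1' : u1 x y t = v1 x y t + κ * pd1 L x y t := by rw [eu1]
    have hu2' : u2 x y t = v2 x y t + κ * pd2 L x y t := by rw [eu2]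
    have hη0 := hne x y t
    simp only [hBh, hB]
    rw [h1, h2, eη11, eη22, du11, du22, eη1, eη2, hu1', hu2']
    field_simp
    ring
  have sB : JointlySmooth B := by
    have h : ContDiff ℝ ∞ (fun p : ℝ × ℝ × ℝ =>
        (u1 p.1 p.2.1 p.2.2 ^ 2 + u2 p.1 p.2.1 p.2.2 ^ 2) / 2
        - (κ / η p.1 p.2.1 p.2.2) * (pd1 (fun x y t => η x y t * u1 x y t) p.1 p.2.1 p.2.2
            + pd2 (fun x y t => η x y t * u2 x y t) p.1 p.2.1 p.2.2)
        - η p.1 p.2.1 p.2.2) := by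
      have m1 : JointlySmooth (fun x y t => η x y t * u1 x y t) := ContDiff.mul hη hu1
      have m2 : JointlySmooth (fun x y t => η x y t * u2 x y t) := ContDiff.mul hη hu2
      exact ((((hu1.pow 2).add (hu2.pow 2)).div_const 2).sub
        ((contDiff_const.div hη fun p => hne _ _ _).mul (ContDiff.add m1.pd1 m2.pd2))).sub hη
    exact hB ▸ h
  refine ⟨fun x y t => ?_, fun x y t => ?_, hcont'⟩
  · have hB1 : pd1 Bh x y t
        = pd1 B x y t + κ * (pd1 (pd1 v1) x y t + pd1 (pd2 v2) x y t) := by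
      rw [eBh]
      exact ((sB.hasDerivAt_pd1 x y t).add
      (((sv1.pd1.hasDerivAt_pd1 x y t).add (sv2.pd2.hasDerivAt_pd1 x y t)).const_mul κ)).deriv
    have hLt := (eLt ▸ sL.hasDerivAt_pdt_pd1 x y t).unique
      (((sv1.pd1.hasDerivAt_pd1 x y t).add (sv2.pd2.hasDerivAt_pd1 x y t)).neg.sub
        (((sv1.hasDerivAt_pd1 x y t).mul (sp1.hasDerivAt_pd1 x y t)).add
          ((sv2.hasDerivAt_pd1 x y t).mul (sp2.hasDerivAt_pd1 x y t))))
    have h := hmom1 x y t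
    rw [du1t, du11, du12, hLt] at h
    have hu1' : u1 x y t = v1 x y t + κ * pd1 L x y t := by rw [eu1]
    have hu2' : u2 x y t = v2 x y t + κ * pd2 L x y t := by rw [eu2]
    rw [hu1', hu2'] at h
    rw [hB1]
    linear_combination h
  · have hB2 : pd2 Bh x y t
        = pd2 B x y t + κ * (pd2 (pd1 v1) x y t + pd2 (pd2 v2) x y t) := by
      rw [eBh]
      exact ((sB.hasDerivAt_pd2 x y t).add
      (((sv1.pd1.hasDerivAt_pd2 x y t).add (sv2.pd2.hasDerivAt_pd2 x y t)).const_mul κ)).deriv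
    have hLt := (eLt ▸ sL.hasDerivAt_pdt_pd2 x y t).unique
      (((sv1.pd1.hasDerivAt_pd2 x y t).add (sv2.pd2.hasDerivAt_pd2 x y t)).neg.sub
        (((sv1.hasDerivAt_pd2 x y t).mul (sp1.hasDerivAt_pd2 x y t)).add
          ((sv2.hasDerivAt_pd2 x y t).mul (sp2.hasDerivAt_pd2 x y t))))
    have h := hmom2 x y t
    rw [du2t, du21, du22, hLt, sL.pd2_pd1] at h
    have hu1' : u1 x y t = v1 x y t + κ * pd1 L x y t := by rw [eu1]
    have hu2' : u2 x y t = v2 x y t + κ * pd2 L x y t := by rw [eu2]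
    rw [hu1', hu2'] at h
    rw [hB2]
    linear_combination h
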